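/- arXiv:0802.1240 — 2 statements merged into one kernel-verified Lean document; each statement's English description precedes it below -/
import Mathlib

section
/- Let Ω be a complete separable metric space, 𝒫 a nonempty family of Borel probability measures on Ω, 𝔼[Y] := sup_{P∈𝒫} E_P[Y], and p > 0. For a Borel function X with 𝔼[|X|^p] < ∞, the following are equivalent: (i) there exists a sequence (X_n) of bounded continuous functions on Ω with 𝔼[|X − X_n|^p] → 0 (i.e. X ∈ 𝕃^p_c, the completion of C_b(Ω) in 𝕃^p); (ii) X has a quasi-continuous version and lim_{n→∞} 𝔼[|X|^p · 1_{{|X| > n}}] = 0. -/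
open MeasureTheory Filter Topology ENNReal

/-- The capacity `c(A) = sup_{P ∈ Ps} P(A)` associated to a family of probability
measures `Ps`. -/
noncomputable def upperCapacity {Ω : Type*} [MeasurableSpace Ω]
    (Ps : Set (MeasureTheory.ProbabilityMeasure Ω)) (A : Set Ω) : ℝ≥0∞ :=
  ⨆ P ∈ Ps, (P : MeasureTheory.Measure Ω) A

/-- A function `Y : Ω → ℝ` is quasi-continuous (w.r.t. the capacity of the family `Ps`)
if for every `ε > 0` there is an open set `O` with `c(O) < ε` such that the restriction
of `Y` to `Oᶜ` is continuous. -/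
def UpperQuasiContinuous {Ω : Type*} [TopologicalSpace Ω] [MeasurableSpace Ω]
    (Ps : Set (MeasureTheory.ProbabilityMeasure Ω)) (Y : Ω → ℝ) : Prop :=
  ∀ ε : ℝ≥0∞, 0 < ε → ∃ O : Set Ω, IsOpen O ∧ upperCapacity Ps O < ε ∧
    Continuous fun x : (Oᶜ : Set Ω) => Y x

section UpperCapacity

variable {Ω : Type*} [MeasurableSpace Ω] {Ps : Set (ProbabilityMeasure Ω)}

theorem upperCapacity_mono {A B : Set Ω} (h : A ⊆ B) :
    upperCapacity Ps A ≤ upperCapacity Ps B :=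
  iSup₂_mono fun _ _ => measure_mono h

theorem measure_le_upperCapacity {P : ProbabilityMeasure Ω} (hP : P ∈ Ps) (A : Set Ω) :
    (P : Measure Ω) A ≤ upperCapacity Ps A :=
  le_iSup₂ (f := fun (P : ProbabilityMeasure Ω) (_ : P ∈ Ps) => (P : Measure Ω) A) P hP

theorem upperCapacity_union_le (A B : Set Ω) :
    upperCapacity Ps (A ∪ B) ≤ upperCapacity Ps A + upperCapacity Ps B :=
  iSup₂_le fun _ hP => (measure_union_le A B).trans
    (add_le_add (measure_le_upperCapacity hP A) (measure_le_upperCapacity hP B))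

theorem upperCapacity_iUnion_le (A : ℕ → Set Ω) :
    upperCapacity Ps (⋃ n, A n) ≤ ∑' n, upperCapacity Ps (A n) :=
  iSup₂_le fun _ hP => (measure_iUnion_le A).trans
    (ENNReal.tsum_le_tsum fun n => measure_le_upperCapacity hP (A n))

theorem tendsto_upperCapacity_iUnion_add {A : ℕ → Set Ω}
    (hA : ∑' n, upperCapacity Ps (A n) ≠ ∞) :
    Tendsto (fun k => upperCapacity Ps (⋃ j, A (j + k))) atTop (𝓝 0) :=
  tendsto_of_tendsto_of_tendsto_of_le_of_le tendsto_const_nhds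
    (ENNReal.tendsto_sum_nat_add _ hA) (fun _ => zero_le)
    fun k => upperCapacity_iUnion_le fun j => A (j + k)

/-- Markov's inequality for the upper expectation of `|f| ^ p`. -/
theorem mul_upperCapacity_lt_abs_le {f : Ω → ℝ} (hf : Measurable f) {p δ : ℝ} (hp : 0 < p)
    (hδ : 0 < δ) :
    ENNReal.ofReal (δ ^ p) * upperCapacity Ps {ω | δ < |f ω|} ≤
      ⨆ P ∈ Ps, ∫⁻ ω, ENNReal.ofReal (|f ω| ^ p) ∂(P : Measure Ω) := by
  simp only [upperCapacity, ENNReal.mul_iSup]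
  refine iSup₂_mono fun P _ => ?_
  have hm : Measurable fun ω => ENNReal.ofReal (|f ω| ^ p) := by fun_prop
  refine le_trans ?_ (mul_meas_ge_le_lintegral (μ := (P : Measure Ω)) hm (ENNReal.ofReal (δ ^ p)))
  gcongr with ω
  intro hω
  exact ENNReal.ofReal_le_ofReal (Real.rpow_le_rpow hδ.le (le_of_lt hω) hp.le)

/-- Continuous functions converging fast in capacity have a quasi-continuous limit. -/
theorem exists_upperQuasiContinuous_version [TopologicalSpace Ω] [BorelSpace Ω]
    {X : Ω → ℝ} (hX : Measurable X) {Z : ℕ → Ω → ℝ} (hZ : ∀ n, Continuous (Z n))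
    (hXZ : ∑' n, upperCapacity Ps {ω | (1 / 2 : ℝ) ^ n < |X ω - Z n ω|} ≠ ∞) :
    ∃ Y : Ω → ℝ, UpperQuasiContinuous Ps Y ∧
      ∃ N : Set Ω, MeasurableSet N ∧ upperCapacity Ps N = 0 ∧ ∀ ω ∉ N, X ω = Y ω := by
  set A : ℕ → Set Ω := fun n => {ω | (1 / 2 : ℝ) ^ n < |X ω - Z n ω|} with hA
  have hAm : ∀ n, MeasurableSet (A n) := fun n =>
    measurableSet_lt measurable_const (hX.sub (hZ n).measurable).abs
  have htail := tendsto_upperCapacity_iUnion_add hXZ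
  refine ⟨fun ω => limUnder atTop fun n => Z n ω, ?_, ⋂ k, ⋃ j, A (j + k),
    .iInter fun k => .iUnion fun j => hAm _, ?_, ?_⟩
  · intro ε hε
    obtain ⟨k, hk⟩ := (htail.eventually (gt_mem_nhds hε)).exists
    set U : ℕ → Set Ω := fun j =>
      {ω | 2 * (1 / 2 : ℝ) ^ k * (1 / 2) ^ j < |Z (j + k) ω - Z (j + 1 + k) ω|}
    refine ⟨⋃ j, U j, isOpen_iUnion fun j => isOpen_lt continuous_const
      ((hZ _).sub (hZ _)).abs, lt_of_le_of_lt (upperCapacity_mono ?_) hk, ?_⟩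
    · refine Set.iUnion_subset fun j ω hω => ?_
      by_contra hcon
      simp only [Set.mem_iUnion, not_exists, Set.mem_ofPred_eq, not_lt] at hcon
      have h1 := hcon j
      have h2 := hcon (j + 1)
      have h3 : 2 * (1 / 2 : ℝ) ^ k * (1 / 2) ^ j < |Z (j + k) ω - Z (j + 1 + k) ω| := hω
      have h4 := abs_sub_le (Z (j + k) ω) (X ω) (Z (j + 1 + k) ω)
      rw [abs_sub_comm (Z (j + k) ω) (X ω)] at h4
      have h5 : (0 : ℝ) < (1 / 2) ^ k * (1 / 2) ^ j := by positivity
      simp only [pow_add, pow_one] at h1 h2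
      nlinarith
    · have hdist : ∀ ω ∈ (⋃ j, U j)ᶜ, ∀ j,
          dist (Z (j + k) ω) (Z (j + 1 + k) ω) ≤ 2 * (1 / 2 : ℝ) ^ k * (1 / 2) ^ j := by
        intro ω hω j
        rw [Real.dist_eq]
        exact not_lt.mp fun h => hω (Set.mem_iUnion.2 ⟨j, h⟩)
      have hlim : ∀ ω ∈ (⋃ j, U j)ᶜ,
          Tendsto (fun j => Z (j + k) ω) atTop (𝓝 (limUnder atTop fun n => Z n ω)) := by
        intro ω hω
        obtain ⟨a, ha⟩ := cauchySeq_tendsto_of_complete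
          (cauchySeq_of_le_geometric (1 / 2 : ℝ) _ (by norm_num) (hdist ω hω))
        rwa [((tendsto_add_atTop_iff_nat (f := fun n => Z n ω) k).1 ha).limUnder_eq]
      have hunif : TendstoUniformly (fun j (x : ((⋃ j, U j)ᶜ : Set Ω)) => Z (j + k) x)
          (fun x => limUnder atTop fun n => Z n x) atTop := by
        rw [Metric.tendstoUniformly_iff]
        intro η hη
        have h0 : Tendsto (fun j : ℕ => 2 * (1 / 2 : ℝ) ^ k * (1 / 2) ^ j / (1 - 1 / 2)) atTop
            (𝓝 0) := by
          simpa using ((tendsto_pow_atTop_nhds_zero_of_lt_one (r := (1 / 2 : ℝ)) (by norm_num)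
            (by norm_num)).const_mul (2 * (1 / 2 : ℝ) ^ k)).div_const (1 - 1 / 2)
        filter_upwards [h0.eventually (gt_mem_nhds hη)] with j hj x
        rw [dist_comm]
        exact (dist_le_of_le_geometric_of_tendsto (1 / 2 : ℝ) _ (by norm_num) (hdist x x.2)
          (hlim x x.2) j).trans_lt hj
      exact hunif.continuous
        (Frequently.of_forall fun j => (hZ _).comp continuous_subtype_val)
  · exact le_antisymm (ge_of_tendsto' htail fun k =>
      upperCapacity_mono (Set.iInter_subset _ k)) zero_le
  · intro ω hω
    simp only [Set.mem_iInter, not_forall] at hω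
    obtain ⟨k, hk⟩ := hω
    simp only [Set.mem_iUnion, not_exists, hA, Set.mem_ofPred_eq, not_lt] at hk
    refine (Tendsto.limUnder_eq ?_).symm
    rw [← tendsto_add_atTop_iff_nat k, tendsto_iff_dist_tendsto_zero]
    refine squeeze_zero (fun _ => dist_nonneg) (fun j => ?_)
      ((tendsto_add_atTop_iff_nat k).2 (tendsto_pow_atTop_nhds_zero_of_lt_one
        (r := (1 / 2 : ℝ)) (by norm_num) (by norm_num)))
    rw [dist_comm, Real.dist_eq]
    exact hk j

theorem tendsto_iSup_setLIntegral_abs_rpow {p : ℝ} (hp : 0 < p) {X : Ω → ℝ} (hX : Measurable X)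
    {Z : ℕ → Ω → ℝ} (hbdd : ∀ n, ∃ M : ℝ, ∀ ω, |Z n ω| ≤ M)
    (hXZ : Tendsto
      (fun n => ⨆ P ∈ Ps, ∫⁻ ω, ENNReal.ofReal (|X ω - Z n ω| ^ p) ∂(P : Measure Ω))
      atTop (𝓝 0)) :
    Tendsto
      (fun n : ℕ => ⨆ P ∈ Ps,
        ∫⁻ ω in {ω' | (n : ℝ) < |X ω'|}, ENNReal.ofReal (|X ω| ^ p) ∂(P : Measure Ω))
      atTop (𝓝 0) := by
  have hC : Tendsto (fun n => ENNReal.ofReal (2 ^ p) *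
      ⨆ P ∈ Ps, ∫⁻ ω, ENNReal.ofReal (|X ω - Z n ω| ^ p) ∂(P : Measure Ω)) atTop (𝓝 0) := by
    simpa using ENNReal.Tendsto.const_mul hXZ (.inr ENNReal.ofReal_ne_top)
  rw [ENNReal.tendsto_nhds_zero] at hC ⊢
  intro ε hε
  obtain ⟨k, hk⟩ := (hC ε hε).exists
  obtain ⟨M, hM⟩ := hbdd k
  filter_upwards [eventually_ge_atTop ⌈2 * M⌉₊] with n hn
  have hn : 2 * M ≤ n := Nat.ceil_le.1 hn
  refine le_trans ?_ hk
  simp only [ENNReal.mul_iSup]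
  refine iSup₂_mono fun P _ => ?_
  rw [← lintegral_const_mul' _ _ ENNReal.ofReal_ne_top]
  refine (setLIntegral_mono' (measurableSet_lt measurable_const hX.abs) fun ω hω => ?_).trans
    (setLIntegral_le_lintegral _ _)
  rw [← ENNReal.ofReal_mul (by positivity), ← Real.mul_rpow (by norm_num) (abs_nonneg _)]
  refine ENNReal.ofReal_le_ofReal (Real.rpow_le_rpow (abs_nonneg _) ?_ hp.le)
  have h1 : (n : ℝ) < |X ω| := hω
  have h2 := hM ω
  have h3 := abs_sub_abs_le_abs_sub (X ω) (Z k ω)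
  linarith

/-- Tietze extension of the truncation of a quasi-continuous version. -/
theorem exists_continuous_abs_le_and_iSup_lintegral_le [TopologicalSpace Ω] [NormalSpace Ω]
    [OpensMeasurableSpace Ω] {p : ℝ} (hp : 0 < p) {X Y : Ω → ℝ} (hX : Measurable X)
    (hY : UpperQuasiContinuous Ps Y) {N : Set Ω} (hN : MeasurableSet N)
    (hN0 : upperCapacity Ps N = 0) (hXY : ∀ ω ∉ N, X ω = Y ω) {n : ℝ} (hn : 0 ≤ n)
    {ε : ℝ≥0∞} (hε : 0 < ε) :
    ∃ g : Ω → ℝ, Continuous g ∧ (∀ ω, |g ω| ≤ n) ∧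
      ⨆ P ∈ Ps, ∫⁻ ω, ENNReal.ofReal (|X ω - g ω| ^ p) ∂(P : Measure Ω) ≤
        ENNReal.ofReal (2 ^ p) * (⨆ P ∈ Ps,
          ∫⁻ ω in {ω' | n < |X ω'|}, ENNReal.ofReal (|X ω| ^ p) ∂(P : Measure Ω)) +
        ENNReal.ofReal ((2 * n) ^ p) * ε := by
  obtain ⟨O, hO, hOε, hYO⟩ := hY ε hε
  have hnn : -n ≤ n := by linarith
  obtain ⟨g, hg, hgO⟩ := ContinuousMap.exists_restrict_eq_forall_mem_of_closed
    (s := Oᶜ) (t := Set.Icc (-n) n)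
    ⟨fun x => max (-n) (min n (Y x)), continuous_const.max (continuous_const.min hYO)⟩
    (fun x => ⟨le_max_left _ _, max_le hnn (min_le_left _ _)⟩) ⟨-n, le_rfl, hnn⟩
    hO.isClosed_compl
  have hgn : ∀ ω, |g ω| ≤ n := fun ω => abs_le.2 (hg ω)
  refine ⟨g, g.continuous, hgn, iSup₂_le fun P hP => ?_⟩
  have hmX : MeasurableSet {ω' | n < |X ω'|} := measurableSet_lt measurable_const hX.abs
  have hmB : MeasurableSet (O ∪ N) := hO.measurableSet.union hN
  have hcap : upperCapacity Ps (O ∪ N) ≤ ε :=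
    (upperCapacity_union_le O N).trans (by simpa [hN0] using hOε.le)
  have hpt : ∀ ω, ENNReal.ofReal (|X ω - g ω| ^ p) ≤
      {ω' | n < |X ω'|}.indicator
        (fun ω => ENNReal.ofReal (2 ^ p) * ENNReal.ofReal (|X ω| ^ p)) ω +
      (O ∪ N).indicator (fun _ => ENNReal.ofReal ((2 * n) ^ p)) ω := by
    intro ω
    have habs := abs_sub (X ω) (g ω)
    have hgω := hgn ω
    by_cases h1 : n < |X ω|
    · refine le_add_right ?_
      rw [Set.indicator_of_mem (show ω ∈ {ω' | n < |X ω'|} from h1),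
        ← ENNReal.ofReal_mul (by positivity), ← Real.mul_rpow (by norm_num) (abs_nonneg _)]
      exact ENNReal.ofReal_le_ofReal
        (Real.rpow_le_rpow (abs_nonneg _) (by linarith) hp.le)
    · push Not at h1
      by_cases h2 : ω ∈ O ∪ N
      · refine le_add_left ?_
        rw [Set.indicator_of_mem h2]
        exact ENNReal.ofReal_le_ofReal
          (Real.rpow_le_rpow (abs_nonneg _) (by linarith) hp.le)
      · simp only [Set.mem_union, not_or] at h2
        have h3 : g ω = X ω := by
          have h4 : g ω = max (-n) (min n (Y ω)) := DFunLike.congr_fun hgO ⟨ω, h2.1⟩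
          rw [h4, ← hXY ω h2.2, min_eq_right (abs_le.1 h1).2, max_eq_right (abs_le.1 h1).1]
        simp [h3, Real.zero_rpow hp.ne']
  refine (lintegral_mono hpt).trans ?_
  rw [lintegral_add_right _ (measurable_const.indicator hmB), lintegral_indicator hmX,
    lintegral_indicator_const hmB, lintegral_const_mul' _ _ ENNReal.ofReal_ne_top]
  gcongr
  · exact le_iSup₂ (f := fun (P : ProbabilityMeasure Ω) (_ : P ∈ Ps) =>
      ∫⁻ ω in {ω' | n < |X ω'|}, ENNReal.ofReal (|X ω| ^ p) ∂(P : Measure Ω)) P hP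
  · exact (measure_le_upperCapacity hP _).trans hcap

end UpperCapacity

/-- Characterization of `𝕃^p_c`, the completion of `C_b(Ω)` under
`𝔼[|·|^p]` with `𝔼[Z] = sup_{P ∈ Ps} E_P[Z]`: a Borel function `X` with `𝔼[|X|^p] < ∞`
is approximable by bounded continuous functions if and only if `X` has a quasi-continuous
version and `𝔼[|X|^p 1_{{|X| > n}}] → 0`. -/
theorem mem_Lp_c_iff
    {Ω : Type*} [MetricSpace Ω] [CompleteSpace Ω] [TopologicalSpace.SeparableSpace Ω]
    [MeasurableSpace Ω] [BorelSpace Ω]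
    (Ps : Set (ProbabilityMeasure Ω)) (hPs : Ps.Nonempty)
    (p : ℝ) (hp : 0 < p)
    (X : Ω → ℝ) (hX : Measurable X)
    (hXfin : (⨆ P ∈ Ps, ∫⁻ ω, ENNReal.ofReal (|X ω| ^ p) ∂(P : Measure Ω)) < ⊤) :
    (∃ Xn : ℕ → Ω → ℝ, (∀ n, Continuous (Xn n)) ∧ (∀ n, ∃ M : ℝ, ∀ ω, |Xn n ω| ≤ M) ∧
      Tendsto
        (fun n => ⨆ P ∈ Ps, ∫⁻ ω, ENNReal.ofReal (|X ω - Xn n ω| ^ p) ∂(P : Measure Ω))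
        atTop (𝓝 0)) ↔
    ((∃ Y : Ω → ℝ, UpperQuasiContinuous Ps Y ∧
        ∃ N : Set Ω, MeasurableSet N ∧ upperCapacity Ps N = 0 ∧ ∀ ω ∉ N, X ω = Y ω) ∧
      Tendsto
        (fun n : ℕ => ⨆ P ∈ Ps,
          ∫⁻ ω in {ω' | (n : ℝ) < |X ω'|}, ENNReal.ofReal (|X ω| ^ p) ∂(P : Measure Ω))
        atTop (𝓝 0)) := by
  constructor
  · rintro ⟨Z, hZ, hbdd, hlim⟩
    refine ⟨?_, tendsto_iSup_setLIntegral_abs_rpow hp hX hbdd hlim⟩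
    have hsub : ∀ k : ℕ, ∃ n,
        upperCapacity Ps {ω | (1 / 2 : ℝ) ^ k < |X ω - Z n ω|} ≤ (2⁻¹ : ℝ≥0∞) ^ k := by
      intro k
      have hδ : (0 : ℝ) < (1 / 2) ^ k := by positivity
      have hpos : 0 < ENNReal.ofReal (((1 / 2 : ℝ) ^ k) ^ p) :=
        ENNReal.ofReal_pos.2 (by positivity)
      have hpos' : 0 < ENNReal.ofReal (((1 / 2 : ℝ) ^ k) ^ p) * (2⁻¹ : ℝ≥0∞) ^ k :=
        ENNReal.mul_pos hpos.ne' (by simp)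
      obtain ⟨n, hn⟩ := (hlim.eventually (gt_mem_nhds hpos')).exists
      refine ⟨n, (ENNReal.mul_le_mul_iff_right hpos.ne' ENNReal.ofReal_ne_top).1 ?_⟩
      exact (mul_upperCapacity_lt_abs_le (hX.sub (hZ n).measurable) hp hδ).trans hn.le
    choose φ hφ using hsub
    refine exists_upperQuasiContinuous_version hX (fun k => hZ (φ k))
      (ne_top_of_le_ne_top ?_ (ENNReal.tsum_le_tsum hφ))
    simp [ENNReal.tsum_geometric]
  · rintro ⟨⟨Y, hY, N, hN, hN0, hXY⟩, hlim⟩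
    have happrox : ∀ n : ℕ, ∃ g : Ω → ℝ, Continuous g ∧ (∀ ω, |g ω| ≤ n) ∧
        ⨆ P ∈ Ps, ∫⁻ ω, ENNReal.ofReal (|X ω - g ω| ^ p) ∂(P : Measure Ω) ≤
          ENNReal.ofReal (2 ^ p) * (⨆ P ∈ Ps,
            ∫⁻ ω in {ω' | (n : ℝ) < |X ω'|}, ENNReal.ofReal (|X ω| ^ p) ∂(P : Measure Ω)) +
          (n : ℝ≥0∞)⁻¹ := by
      intro n
      obtain ⟨g, hg, hgn, hle⟩ := exists_continuous_abs_le_and_iSup_lintegral_le hp hX hY hN hN0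
        hXY n.cast_nonneg (ε := (n : ℝ≥0∞)⁻¹ / ENNReal.ofReal ((2 * n) ^ p))
        (ENNReal.div_pos (by simp) ENNReal.ofReal_ne_top)
      exact ⟨g, hg, hgn, hle.trans (by gcongr; exact ENNReal.mul_div_le)⟩
    choose g hg hgn hle using happrox
    refine ⟨g, hg, fun n => ⟨n, hgn n⟩, tendsto_of_tendsto_of_tendsto_of_le_of_le
      tendsto_const_nhds ?_ (fun _ => zero_le) hle⟩
    simpa using (ENNReal.Tendsto.const_mul hlim (.inr ENNReal.ofReal_ne_top)).add
      ENNReal.tendsto_inv_nat_nhds_zero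
end

section
/- Let Ω be a complete separable metric space and 𝒫 a nonempty family of Borel probability measures on Ω that is compact in the topology of weak convergence, with 𝔼[Y] := sup_{P∈𝒫} E_P[Y]. Let (X_n) be a sequence of Borel functions in 𝕃^1_c (each X_n has a quasi-continuous version, 𝔼[|X_n|] < ∞, and lim_N 𝔼[|X_n|·1_{{|X_n|>N}}] = 0) such that X_n ↓ X quasi-surely, where X is a Borel function whose integral E_P[X] exists (possibly −∞) for each P ∈ 𝒫. Then 𝔼[X_n] ↓ 𝔼[X]. In particular, if X_n ↓ 0 quasi-surely then 𝔼[X_n] ↓ 0. -/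
open MeasureTheory Filter Topology ENNReal

/-- The integral `E_P[X] = E_P[X⁺] - E_P[X⁻]`, with values in `EReal` (it equals `-∞`
when the negative part has infinite integral but the positive part is integrable). -/
noncomputable def erealIntegral {Ω : Type*} [MeasurableSpace Ω]
    (P : MeasureTheory.Measure Ω) (X : Ω → ℝ) : EReal :=
  ((∫⁻ ω, ENNReal.ofReal (X ω) ∂P : ℝ≥0∞) : EReal) -
    ((∫⁻ ω, ENNReal.ofReal (-(X ω)) ∂P : ℝ≥0∞) : EReal)

/-- A property holding outside a set of capacity zero holds almost surely under each measure. -/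
theorem ae_of_upperCapacity_eq_zero {Ω : Type*} [MeasurableSpace Ω]
    {Ps : Set (ProbabilityMeasure Ω)} {N : Set Ω} (hN : upperCapacity Ps N = 0)
    {p : Ω → Prop} (hp : ∀ ω ∉ N, p ω) {P : ProbabilityMeasure Ω} (hP : P ∈ Ps) :
    ∀ᵐ ω ∂(P : Measure Ω), p ω := by
  have h0 : (P : Measure Ω) N = 0 :=
    le_antisymm (hN ▸ le_iSup₂ (f := fun (P : ProbabilityMeasure Ω) (_ : P ∈ Ps) =>
      (P : Measure Ω) N) P hP) zero_le
  filter_upwards [measure_eq_zero_iff_ae_notMem.1 h0] with ω hω using hp ω hω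

theorem erealIntegral_mono_ae {Ω : Type*} [MeasurableSpace Ω] {P : Measure Ω} {X Y : Ω → ℝ}
    (h : ∀ᵐ ω ∂P, X ω ≤ Y ω) : erealIntegral P X ≤ erealIntegral P Y := by
  refine EReal.sub_le_sub ?_ ?_
  · refine EReal.coe_ennreal_le_coe_ennreal_iff.2 (lintegral_mono_ae ?_)
    filter_upwards [h] with ω hω using ENNReal.ofReal_le_ofReal hω
  · refine EReal.coe_ennreal_le_coe_ennreal_iff.2 (lintegral_mono_ae ?_)
    filter_upwards [h] with ω hω using ENNReal.ofReal_le_ofReal (neg_le_neg hω)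

theorem erealIntegral_eq_integral {Ω : Type*} [MeasurableSpace Ω] {P : Measure Ω} {X : Ω → ℝ}
    (h : Integrable X P) : erealIntegral P X = ((∫ ω, X ω ∂P : ℝ) : EReal) := by
  rw [erealIntegral, integral_eq_lintegral_pos_part_sub_lintegral_neg_part h, EReal.coe_sub,
    EReal.coe_ennreal_toReal h.lintegral_lt_top.ne,
    EReal.coe_ennreal_toReal (by simpa using h.neg.lintegral_lt_top.ne)]

theorem tendsto_erealIntegral_of_antitone {Ω : Type*} [MeasurableSpace Ω] {P : Measure Ω}
    {X : ℕ → Ω → ℝ} {Y : Ω → ℝ} (hX : ∀ n, Measurable (X n)) (h0 : Integrable (X 0) P)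
    (hdec : ∀ᵐ ω ∂P, (Antitone fun n => X n ω) ∧ Tendsto (fun n => X n ω) atTop (𝓝 (Y ω)))
    (hY : ∫⁻ ω, ENNReal.ofReal (Y ω) ∂P ≠ ⊤) :
    Tendsto (fun n => erealIntegral P (X n)) atTop (𝓝 (erealIntegral P Y)) := by
  have hpos : Tendsto (fun n => ∫⁻ ω, ENNReal.ofReal (X n ω) ∂P) atTop
      (𝓝 (∫⁻ ω, ENNReal.ofReal (Y ω) ∂P)) := by
    refine tendsto_lintegral_of_dominated_convergence (fun ω => ENNReal.ofReal (X 0 ω))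
      (fun n => (hX n).ennreal_ofReal) (fun n => ?_) h0.lintegral_lt_top.ne ?_
    · filter_upwards [hdec] with ω hω using ENNReal.ofReal_le_ofReal (hω.1 (Nat.zero_le n))
    · filter_upwards [hdec] with ω hω using ENNReal.tendsto_ofReal hω.2
  have hneg : Tendsto (fun n => ∫⁻ ω, ENNReal.ofReal (-(X n ω)) ∂P) atTop
      (𝓝 (∫⁻ ω, ENNReal.ofReal (-(Y ω)) ∂P)) := by
    refine lintegral_tendsto_of_tendsto_of_monotone
      (fun n => (hX n).neg.ennreal_ofReal.aemeasurable) ?_ ?_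
    · filter_upwards [hdec] with ω hω
      exact fun m n hmn => ENNReal.ofReal_le_ofReal (neg_le_neg (hω.1 hmn))
    · filter_upwards [hdec] with ω hω using ENNReal.tendsto_ofReal hω.2.neg
  have hpos' := (continuous_coe_ennreal_ereal.tendsto _).comp hpos
  have hneg' := (continuous_neg.tendsto _).comp ((continuous_coe_ennreal_ereal.tendsto _).comp hneg)
  refine (EReal.continuousAt_add ?_ ?_).tendsto.comp (hpos'.prodMk_nhds hneg')
  · left; simpa using hY
  · left; simp

theorem abs_sub_max_min_le (x k : ℝ) (hk : 0 ≤ k) :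
    |x - max (-k) (min k x)| ≤ if k < |x| then |x| else 0 := by
  grind

/-- A function with a quasi-continuous version and vanishing truncation tails can be
approximated in `L¹` by bounded continuous functions, uniformly over the family. -/
theorem exists_boundedContinuous_lintegral_sub_le
    {Ω : Type*} [MetricSpace Ω] [MeasurableSpace Ω] [BorelSpace Ω]
    {Ps : Set (ProbabilityMeasure Ω)} {X Z : Ω → ℝ} (hX : Measurable X)
    (hZ : UpperQuasiContinuous Ps Z) {N : Set Ω} (hN : upperCapacity Ps N = 0)
    (hXZ : ∀ ω ∉ N, X ω = Z ω)
    (htail : Tendsto (fun k : ℕ => ⨆ P ∈ Ps,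
        ∫⁻ ω in {ω' | (k : ℝ) < |X ω'|}, ENNReal.ofReal |X ω| ∂(P : Measure Ω)) atTop (𝓝 0))
    {δ : ℝ≥0∞} (hδ : 0 < δ) :
    ∃ f : BoundedContinuousFunction Ω ℝ, ∀ P ∈ Ps,
      ∫⁻ ω, ENNReal.ofReal |X ω - f ω| ∂(P : Measure Ω) ≤ δ := by
  have hδ2 : 0 < δ / 2 := ENNReal.half_pos hδ.ne'
  obtain ⟨k, hk⟩ := ((tendsto_order.1 htail).2 _ hδ2).exists
  obtain ⟨O, hO, hcO, hcont⟩ := hZ (δ / 2 / (2 * k + 1))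
    (ENNReal.div_pos hδ2.ne' (by finiteness))
  let g : BoundedContinuousFunction (Oᶜ : Set Ω) ℝ :=
    BoundedContinuousFunction.ofNormedAddCommGroup
      (fun x : (Oᶜ : Set Ω) => max (-(k : ℝ)) (min k (Z x)))
      (continuous_const.max (continuous_const.min hcont)) k (fun x => by
        rw [Real.norm_eq_abs, abs_le]
        exact ⟨le_max_left _ _, max_le (by linarith [k.cast_nonneg (α := ℝ)]) (min_le_left _ _)⟩)
  obtain ⟨f, hfn, hfr⟩ :=
    BoundedContinuousFunction.exists_norm_eq_domRestrict_eq_of_closed g hO.isClosed_compl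
  have hfk : ∀ ω, |f ω| ≤ k := fun ω => by
    have h1 := f.norm_coe_le_norm ω
    have h2 : ‖g‖ ≤ k := BoundedContinuousFunction.norm_ofNormedAddCommGroup_le _
      (Nat.cast_nonneg k) _
    rw [Real.norm_eq_abs] at h1
    linarith
  have hfO : ∀ ω ∉ O, f ω = max (-(k : ℝ)) (min k (Z ω)) := fun ω hω =>
    DFunLike.congr_fun hfr (⟨ω, hω⟩ : (Oᶜ : Set Ω))
  have hmeas : MeasurableSet {ω' | (k : ℝ) < |X ω'|} := measurableSet_lt measurable_const hX.abs
  refine ⟨f, fun P hP => ?_⟩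
  have hpt : ∀ ω ∉ N, ENNReal.ofReal |X ω - f ω| ≤
      {ω' | (k : ℝ) < |X ω'|}.indicator (fun ω => ENNReal.ofReal |X ω|) ω +
        O.indicator (fun _ => (2 * k : ℝ≥0∞)) ω := by
    intro ω hω
    have h2k : (2 * k : ℝ≥0∞) = ENNReal.ofReal (2 * k) := by
      rw [ENNReal.ofReal_mul (by norm_num)]; simp
    have hk0 : (0 : ℝ) ≤ k := Nat.cast_nonneg k
    by_cases hωO : ω ∈ O
    · rw [Set.indicator_of_mem hωO, h2k]
      by_cases hb : (k : ℝ) < |X ω|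
      · rw [Set.indicator_of_mem (by exact hb), ← ENNReal.ofReal_add (by positivity) (by positivity)]
        exact ENNReal.ofReal_le_ofReal (by linarith [abs_sub (X ω) (f ω), hfk ω])
      · rw [Set.indicator_of_notMem (by exact hb), zero_add]
        exact ENNReal.ofReal_le_ofReal (by linarith [abs_sub (X ω) (f ω), hfk ω])
    · rw [Set.indicator_of_notMem hωO, add_zero, hfO ω hωO, ← hXZ ω hω]
      have := abs_sub_max_min_le (X ω) k hk0
      by_cases hb : (k : ℝ) < |X ω|
      · rw [Set.indicator_of_mem (by exact hb)]
        rw [if_pos hb] at this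
        exact ENNReal.ofReal_le_ofReal this
      · rw [if_neg hb] at this
        simp [ENNReal.ofReal_eq_zero.2 this]
  have hPO : (P : Measure Ω) O ≤ δ / 2 / (2 * k + 1) :=
    (le_iSup₂ (f := fun (P : ProbabilityMeasure Ω) (_ : P ∈ Ps) => (P : Measure Ω) O) P hP).trans
      hcO.le
  calc ∫⁻ ω, ENNReal.ofReal |X ω - f ω| ∂(P : Measure Ω)
      ≤ ∫⁻ ω, ({ω' | (k : ℝ) < |X ω'|}.indicator (fun ω => ENNReal.ofReal |X ω|) ω +
        O.indicator (fun _ => (2 * k : ℝ≥0∞)) ω) ∂(P : Measure Ω) :=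
        lintegral_mono_ae (ae_of_upperCapacity_eq_zero hN hpt hP)
    _ = (∫⁻ ω in {ω' | (k : ℝ) < |X ω'|}, ENNReal.ofReal |X ω| ∂(P : Measure Ω)) +
        2 * k * (P : Measure Ω) O := by
        rw [lintegral_add_left (hX.abs.ennreal_ofReal.indicator hmeas), lintegral_indicator hmeas,
          lintegral_indicator_const hO.measurableSet]
    _ ≤ δ / 2 + δ / 2 := by
        refine add_le_add ((le_iSup₂ (f := fun (P : ProbabilityMeasure Ω) (_ : P ∈ Ps) =>
          ∫⁻ ω in {ω' | (k : ℝ) < |X ω'|}, ENNReal.ofReal |X ω| ∂(P : Measure Ω)) P hP).trans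
            hk.le) ?_
        calc (2 * k : ℝ≥0∞) * (P : Measure Ω) O
            ≤ (2 * k + 1) * (δ / 2 / (2 * k + 1)) := mul_le_mul' le_self_add hPO
          _ ≤ δ / 2 := ENNReal.mul_div_le
    _ = δ := ENNReal.add_halves δ

theorem continuousOn_integral_of_upperQuasiContinuous
    {Ω : Type*} [MetricSpace Ω] [MeasurableSpace Ω] [BorelSpace Ω]
    {Ps : Set (ProbabilityMeasure Ω)} {X Z : Ω → ℝ} (hX : Measurable X)
    (hint : ∀ P ∈ Ps, Integrable X (P : Measure Ω))
    (hZ : UpperQuasiContinuous Ps Z) {N : Set Ω} (hN : upperCapacity Ps N = 0)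
    (hXZ : ∀ ω ∉ N, X ω = Z ω)
    (htail : Tendsto (fun k : ℕ => ⨆ P ∈ Ps,
        ∫⁻ ω in {ω' | (k : ℝ) < |X ω'|}, ENNReal.ofReal |X ω| ∂(P : Measure Ω)) atTop (𝓝 0)) :
    ContinuousOn (fun P : ProbabilityMeasure Ω => ∫ ω, X ω ∂(P : Measure Ω)) Ps := by
  refine continuousOn_of_uniform_approx_of_continuousOn fun u hu => ?_
  obtain ⟨ε, hε, hεu⟩ := Metric.mem_uniformity_dist.1 hu
  obtain ⟨f, hf⟩ := exists_boundedContinuous_lintegral_sub_le hX hZ hN hXZ htail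
    (δ := ENNReal.ofReal (ε / 2)) (by simpa using hε)
  refine ⟨fun P => ∫ ω, f ω ∂(P : Measure Ω), ?_, fun P hP => hεu ?_⟩
  · exact (continuous_iff_continuousAt.2 fun P =>
      ProbabilityMeasure.tendsto_iff_forall_integral_tendsto.1 tendsto_id f).continuousOn
  · have hfi : Integrable f (P : Measure Ω) := f.integrable _
    rw [Real.dist_eq, ← integral_sub (hint P hP) hfi, ← Real.norm_eq_abs]
    refine (norm_integral_le_lintegral_norm _).trans_lt ?_
    have := ENNReal.toReal_le_of_le_ofReal (by positivity) (hf P hP)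
    simp only [Real.norm_eq_abs]
    linarith

/-- Let `Ps` be weakly compact, and let `(Xₙ) ⊆ 𝕃¹_c` decrease
quasi-surely to a Borel function `X` whose integral `E_P[X]` exists (possibly `-∞`) for
each `P ∈ Ps`. Then `𝔼[Xₙ] ↓ 𝔼[X]`, where `𝔼[Z] = sup_{P ∈ Ps} E_P[Z]`. (In particular,
taking `X = 0`, if `Xₙ ↓ 0` quasi-surely then `𝔼[Xₙ] ↓ 0`.) -/
theorem monotone_convergence_downward_L1c
    {Ω : Type*} [MetricSpace Ω] [CompleteSpace Ω] [TopologicalSpace.SeparableSpace Ω]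
    [MeasurableSpace Ω] [BorelSpace Ω]
    (Ps : Set (ProbabilityMeasure Ω)) (hPs : Ps.Nonempty)
    (hcompact : IsCompact Ps)
    (X : ℕ → Ω → ℝ) (Y : Ω → ℝ)
    (hXmeas : ∀ n, Measurable (X n)) (hYmeas : Measurable Y)
    (hXqc : ∀ n, ∃ Z : Ω → ℝ, UpperQuasiContinuous Ps Z ∧
      ∃ N : Set Ω, MeasurableSet N ∧ upperCapacity Ps N = 0 ∧ ∀ ω ∉ N, X n ω = Z ω)
    (hXfin : ∀ n, (⨆ P ∈ Ps, ∫⁻ ω, ENNReal.ofReal |X n ω| ∂(P : Measure Ω)) < ⊤)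
    (hXtail : ∀ n, Tendsto
      (fun k : ℕ => ⨆ P ∈ Ps,
        ∫⁻ ω in {ω' | (k : ℝ) < |X n ω'|}, ENNReal.ofReal |X n ω| ∂(P : Measure Ω))
      atTop (𝓝 0))
    (hdec : ∃ N : Set Ω, MeasurableSet N ∧ upperCapacity Ps N = 0 ∧
      ∀ ω ∉ N, (Antitone fun n => X n ω) ∧ Tendsto (fun n => X n ω) atTop (𝓝 (Y ω)))
    (hYexists : ∀ P ∈ Ps, (∫⁻ ω, ENNReal.ofReal (Y ω) ∂(P : Measure Ω)) ≠ ⊤) :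
    Antitone (fun n => ⨆ P ∈ Ps, erealIntegral (P : Measure Ω) (X n)) ∧
    Tendsto (fun n => ⨆ P ∈ Ps, erealIntegral (P : Measure Ω) (X n)) atTop
      (𝓝 (⨆ P ∈ Ps, erealIntegral (P : Measure Ω) Y)) := by
  obtain ⟨N, -, hN, hdecN⟩ := hdec
  have hdecP : ∀ P ∈ Ps, ∀ᵐ ω ∂(P : Measure Ω),
      (Antitone fun n => X n ω) ∧ Tendsto (fun n => X n ω) atTop (𝓝 (Y ω)) :=
    fun P hP => ae_of_upperCapacity_eq_zero hN hdecN hP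
  have hint : ∀ n, ∀ P ∈ Ps, Integrable (X n) (P : Measure Ω) := fun n P hP => by
    refine ⟨(hXmeas n).aestronglyMeasurable, ?_⟩
    rw [hasFiniteIntegral_iff_norm]
    exact (le_iSup₂ (f := fun (P : ProbabilityMeasure Ω) (_ : P ∈ Ps) =>
      ∫⁻ ω, ENNReal.ofReal |X n ω| ∂(P : Measure Ω)) P hP).trans_lt (hXfin n)
  have hanti : ∀ P ∈ Ps, Antitone fun n => erealIntegral (P : Measure Ω) (X n) :=
    fun P hP m n hmn => erealIntegral_mono_ae ((hdecP P hP).mono fun ω hω => hω.1 hmn)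
  have hYle : ∀ n, ∀ P ∈ Ps,
      erealIntegral (P : Measure Ω) Y ≤ erealIntegral (P : Measure Ω) (X n) := fun n P hP =>
    erealIntegral_mono_ae ((hdecP P hP).mono fun ω hω => hω.1.le_of_tendsto hω.2 n)
  refine ⟨fun m n hmn => iSup₂_mono fun P hP => hanti P hP hmn, tendsto_order.2 ⟨fun b hb =>
    Eventually.of_forall fun n => hb.trans_le (iSup₂_mono fun P hP => hYle n P hP),
    fun a ha => ?_⟩⟩
  obtain ⟨b, hYb, hba⟩ := exists_between ha
  obtain ⟨n, hn⟩ : ∃ n, ∀ P ∈ Ps, P ∈ Ps → erealIntegral (P : Measure Ω) (X n) ≤ b := by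
    refine hcompact.induction_on
      (p := fun s => ∃ n, ∀ P ∈ s, P ∈ Ps → erealIntegral (P : Measure Ω) (X n) ≤ b)
      ⟨0, fun P hP => hP.elim⟩ ?_ ?_ ?_
    · rintro s t hst ⟨n, hn⟩
      exact ⟨n, fun P hP => hn P (hst hP)⟩
    · rintro s t ⟨m, hm⟩ ⟨n, hn⟩
      refine ⟨max m n, ?_⟩
      rintro P (hP | hP) hPs
      · exact (hanti P hPs (le_max_left m n)).trans (hm P hP hPs)
      · exact (hanti P hPs (le_max_right m n)).trans (hn P hP hPs)
    · intro P hP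
      have hlt : erealIntegral (P : Measure Ω) Y < b :=
        (le_iSup₂ (f := fun (P : ProbabilityMeasure Ω) (_ : P ∈ Ps) =>
          erealIntegral (P : Measure Ω) Y) P hP).trans_lt hYb
      obtain ⟨n, hn⟩ := ((tendsto_order.1 (tendsto_erealIntegral_of_antitone hXmeas (hint 0 P hP)
        (hdecP P hP) (hYexists P hP))).2 b hlt).exists
      obtain ⟨Z, hZ, M, -, hM, hXZ⟩ := hXqc n
      have hcont := continuousOn_integral_of_upperQuasiContinuous (hXmeas n) (hint n) hZ hM hXZ
        (hXtail n)
      rw [erealIntegral_eq_integral (hint n P hP)] at hn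
      refine ⟨_, ((continuous_coe_real_ereal.tendsto _).comp (hcont P hP)).eventually_lt_const hn,
        n, fun Q hQ hQs => ?_⟩
      rw [erealIntegral_eq_integral (hint n Q hQs)]
      exact (show _ < b from hQ).le
  filter_upwards [eventually_ge_atTop n] with m hm
  exact (iSup₂_le fun P hP => (hanti P hP hm).trans (hn P hP hP)).trans_lt hba
end
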